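/- arXiv:math/9811041 — 2 statements merged into one kernel-verified Lean document; each statement's English description precedes it below -/
import Mathlib

section
/- Let n = 2m with m ≥ 1. Then in the polynomial ring ℚ[u,v] one has (n!)² · P_n(u,v) = ∏_{i=0}^{m−1} [ (u+v+q_i)(u+v+q_{i+1}) + r_i·u ], where q_i = i(n−i) and r_i = (n−1−2i)². -/
open Finset MvPolynomial

/-- Product of left partial sums of a list of parts (as a rational number). -/
noncomputable def Lval (p : List ℕ) : ℚ :=
  ∏ j ∈ Finset.range p.length, (((p.take (j + 1)).sum : ℕ) : ℚ)

/-- Product of right partial sums. -/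
noncomputable def Rval (p : List ℕ) : ℚ := Lval p.reverse

/-- `S k l n`: the sum over all `l`-compositions `p` of `n` of `e_k(p)/(L(p)R(p))`. -/
noncomputable def Sval (k l n : ℕ) : ℚ :=
  ∑ c ∈ Finset.univ.filter (fun c : Composition n => c.length = l),
    ((c.blocks.map (fun i : ℕ => (i : ℚ)) : Multiset ℚ).esymm k) /
      (Lval c.blocks * Rval c.blocks)

/-- The generating polynomial `P_n(u,v)` in `ℚ[u,v]`, with `X 0 = u`, `X 1 = v`. -/
noncomputable def Pgen (n : ℕ) : MvPolynomial (Fin 2) ℚ :=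
  ∑ l ∈ Finset.Icc 1 n, ∑ k ∈ Finset.range (l + 1),
    C (Sval k l n) * X 0 ^ k * X 1 ^ (l - k)

theorem Lval_append_singleton (p : List ℕ) (b : ℕ) :
    Lval (p ++ [b]) = Lval p * ((p.sum + b : ℕ) : ℚ) := by
  have h : ∀ j ∈ range p.length,
      ((((p ++ [b]).take (j + 1)).sum : ℕ) : ℚ) = ((p.take (j + 1)).sum : ℕ) := by
    intro j hj
    rw [List.take_append_of_le_length (by simpa [Nat.succ_le_iff] using hj)]
  rw [Lval, List.length_append, List.length_singleton, prod_range_succ, prod_congr rfl h, Lval]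
  congr 2
  rw [List.take_of_length_le (by simp)]
  simp

theorem Rval_cons (x : ℕ) (p : List ℕ) :
    Rval (x :: p) = Rval p * ((x + p.sum : ℕ) : ℚ) := by
  rw [Rval, List.reverse_cons, Lval_append_singleton, List.sum_reverse, add_comm, Rval]

theorem Rval_append_singleton (p : List ℕ) (b : ℕ) :
    Rval (p ++ [b]) = ((p.sum + b : ℕ) : ℚ) *
      ∏ j ∈ range p.length, (((p.sum + b : ℕ) : ℚ) - ((p.take (j + 1)).sum : ℕ)) := by
  induction p with
  | nil => simp [Rval, Lval]
  | cons x p ih =>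
    rw [List.cons_append, Rval_cons, ih, List.length_cons, prod_range_succ']
    have h : ∀ j ∈ range p.length,
        (((p.sum + b : ℕ) : ℚ) - ((p.take (j + 1)).sum : ℕ)) =
          ((((x :: p).sum + b : ℕ) : ℚ) - (((x :: p).take (j + 1 + 1)).sum : ℕ)) := by
      intro j _
      simp only [List.take_succ_cons, List.sum_cons]
      push_cast
      ring
    rw [prod_congr rfl h]
    simp only [List.sum_cons, List.sum_append, List.take_succ_cons, List.take_zero, List.sum_nil]
    push_cast
    ring

/-- A sum over the compositions of `n + 1`, organised by the last block. -/
theorem Composition.sum_blocks_succ {M : Type*} [AddCommMonoid M] (n : ℕ) (g : List ℕ → M) :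
    ∑ c : Composition (n + 1), g c.blocks =
      ∑ i ∈ range (n + 1), ∑ c : Composition i, g (c.blocks ++ [n + 1 - i]) := by
  rw [← Fin.sum_univ_eq_sum_range
    (fun i => ∑ c : Composition i, g (c.blocks ++ [n + 1 - i])) (n + 1), ← Fintype.sum_sigma']
  symm
  refine Fintype.sum_bijective
    (fun x : (i : Fin (n + 1)) × Composition (i : ℕ) =>
      (⟨x.2.blocks ++ [n + 1 - x.1], ?_, ?_⟩ : Composition (n + 1))) ⟨?_, ?_⟩ _ _ ?_
  · intro i hi
    have hlt := x.1.isLt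
    rcases List.mem_append.1 hi with h | h
    · exact x.2.blocks_pos h
    · rw [List.mem_singleton] at h
      omega
  · have hlt := x.1.isLt
    simp only [List.sum_append, Composition.blocks_sum, List.sum_cons, List.sum_nil]
    omega
  · rintro ⟨⟨i, hi⟩, c⟩ ⟨⟨j, hj⟩, d⟩ h
    have hb : c.blocks = d.blocks := (List.append_inj' (congrArg Composition.blocks h) rfl).1
    obtain rfl : i = j := c.blocks_sum.symm.trans ((congrArg List.sum hb).trans d.blocks_sum)
    rw [Composition.ext hb]
  · rintro ⟨q, hq, hs⟩
    rcases List.eq_nil_or_concat' q with rfl | ⟨p, b, rfl⟩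
    · simp at hs
    · have hb : 0 < b := hq (by simp)
      have hs' : p.sum + b = n + 1 := by simpa using hs
      refine ⟨⟨⟨p.sum, by omega⟩, ⟨p, fun h => hq (by simp [h]), rfl⟩⟩, ?_⟩
      ext1
      simp only
      congr 2
      omega
  · intro x
    rfl

/-- The weight of a list of parts, with weight `φ b` for a part `b` and `w s` for a nonempty left
partial sum `s`. -/
noncomputable def partialSumWeight (φ w : ℕ → ℚ) (p : List ℕ) : ℚ :=
  (p.map φ).prod * ∏ j ∈ range p.length, w (p.take (j + 1)).sum

theorem partialSumWeight_append_singleton (φ w : ℕ → ℚ) (p : List ℕ) (b : ℕ) :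
    partialSumWeight φ w (p ++ [b]) = partialSumWeight φ w p * (φ b * w (p.sum + b)) := by
  have h : ∀ j ∈ range p.length, w ((p ++ [b]).take (j + 1)).sum = w (p.take (j + 1)).sum := by
    intro j hj
    rw [List.take_append_of_le_length (by simpa [Nat.succ_le_iff] using hj)]
  rw [partialSumWeight, List.length_append, List.length_singleton, prod_range_succ,
    prod_congr rfl h, List.take_of_length_le (by simp), partialSumWeight]
  simp only [List.map_append, List.prod_append, List.sum_append, List.map_cons, List.map_nil,
    List.prod_cons, List.prod_nil, List.sum_cons, List.sum_nil, add_zero]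
  ring

theorem sum_partialSumWeight_succ (φ w : ℕ → ℚ) (n : ℕ) :
    ∑ c : Composition (n + 1), partialSumWeight φ w c.blocks =
      w (n + 1) * ∑ i ∈ range (n + 1),
        φ (n + 1 - i) * ∑ c : Composition i, partialSumWeight φ w c.blocks := by
  rw [Composition.sum_blocks_succ, mul_sum]
  refine sum_congr rfl fun i hi => ?_
  rw [mul_sum, mul_sum]
  refine sum_congr rfl fun c _ => ?_
  rw [partialSumWeight_append_singleton, c.blocks_sum,
    Nat.add_sub_cancel' (mem_range.1 hi).le]
  ring

theorem sum_prod_div_Lval_mul_Rval (φ : ℕ → ℚ) (N : ℕ) :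
    ∑ c : Composition (N + 1), (c.blocks.map φ).prod / (Lval c.blocks * Rval c.blocks) =
      (∑ i ∈ range (N + 1), φ (N + 1 - i) * ∑ c : Composition i,
        partialSumWeight φ (fun s => ((s : ℚ) * (((N + 1 : ℕ) : ℚ) - s))⁻¹) c.blocks) /
          ((N + 1 : ℕ) : ℚ) ^ 2 := by
  rw [Composition.sum_blocks_succ N (fun p => (p.map φ).prod / (Lval p * Rval p)), sum_div]
  refine sum_congr rfl fun i hi => ?_
  rw [mul_sum, sum_div]
  refine sum_congr rfl fun c _ => ?_
  rw [Lval_append_singleton, Rval_append_singleton, c.blocks_sum,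
    Nat.add_sub_cancel' (mem_range.1 hi).le, partialSumWeight, prod_inv_distrib,
    prod_mul_distrib, Lval, List.map_append, List.prod_append, List.map_singleton,
    List.prod_singleton]
  simp only [div_eq_mul_inv, mul_inv]
  ring

theorem Multiset.prod_map_add_mul_eq_sum_esymm {R : Type*} [CommSemiring R] (s : Multiset R)
    (u v : R) :
    (s.map fun x => v + u * x).prod =
      ∑ k ∈ Finset.range (Multiset.card s + 1), s.esymm k * u ^ k * v ^ (Multiset.card s - k) := by
  have h := congrArg (Polynomial.eval v)
    (Multiset.prod_X_add_C_eq_sum_esymm (s.map fun x => u * x))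
  rw [Polynomial.eval_multiset_prod, Polynomial.eval_finsetSum] at h
  simp only [Multiset.map_map, Function.comp_def, Polynomial.eval_add, Polynomial.eval_X,
    Polynomial.eval_C, Polynomial.eval_mul, Polynomial.eval_pow, Multiset.card_map] at h
  rw [h]
  refine Finset.sum_congr rfl fun k _ => ?_
  congr 1
  rw [Multiset.esymm, Multiset.esymm, Multiset.powersetCard_map, Multiset.map_map,
    ← Multiset.sum_map_mul_right]
  congr 1
  refine Multiset.map_congr rfl fun t ht => ?_
  rw [Function.comp_apply, Multiset.prod_map_mul, Multiset.map_const', Multiset.prod_replicate,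
    (Multiset.mem_powersetCard.1 ht).2, Multiset.map_id', mul_comm]

theorem eval_Pgen {n : ℕ} (hn : 1 ≤ n) (x : Fin 2 → ℚ) :
    eval x (Pgen n) = ∑ c : Composition n,
      (c.blocks.map fun b : ℕ => x 1 + x 0 * b).prod / (Lval c.blocks * Rval c.blocks) := by
  have hmem : ∀ c ∈ (univ : Finset (Composition n)), c.length ∈ Icc 1 n := fun c _ =>
    mem_Icc.2 ⟨c.length_pos_of_pos hn, c.length_le⟩
  rw [← sum_fiberwise_of_maps_to hmem, Pgen, map_sum]
  refine sum_congr rfl fun l _ => ?_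
  simp only [map_sum, map_mul, map_pow, eval_C, eval_X, Sval, sum_mul]
  rw [sum_comm]
  refine sum_congr rfl fun c hc => ?_
  have hl : c.blocks.length = l := (mem_filter.1 hc).2
  have h := Multiset.prod_map_add_mul_eq_sum_esymm
    (c.blocks.map (fun i : ℕ => (i : ℚ)) : Multiset ℚ) (x 0) (x 1)
  simp only [Multiset.map_coe, Multiset.prod_coe, Multiset.coe_card, List.length_map,
    List.map_map, Function.comp_def, hl] at h
  rw [h, sum_div]
  refine sum_congr rfl fun k _ => ?_
  ring

/-- The Euler operator `X · d/dX` on power series. -/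
noncomputable def eulerOp : Derivation ℚ (PowerSeries ℚ) (PowerSeries ℚ) :=
  (PowerSeries.X : PowerSeries ℚ) • PowerSeries.derivative ℚ

theorem coeff_eulerOp (f : PowerSeries ℚ) (j : ℕ) :
    PowerSeries.coeff j (eulerOp f) = j * PowerSeries.coeff j f := by
  rw [eulerOp, Derivation.smul_apply, smul_eq_mul]
  cases j with
  | zero => simp
  | succ j =>
    rw [PowerSeries.coeff_succ_X_mul, PowerSeries.coeff_derivative]
    push_cast
    ring

theorem eulerOp_X : eulerOp PowerSeries.X = PowerSeries.X := by
  simp [eulerOp]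

theorem one_sub_X_mul_eulerOp_pow (a : ℕ) :
    (1 - PowerSeries.X) * eulerOp ((1 - PowerSeries.X) ^ a) =
      -(a : PowerSeries ℚ) * PowerSeries.X * (1 - PowerSeries.X) ^ a := by
  rw [Derivation.leibniz_pow, map_sub, eulerOp_X, Derivation.map_one_eq_zero]
  cases a with
  | zero => simp
  | succ a =>
    simp only [smul_eq_mul, nsmul_eq_mul, Nat.add_sub_cancel]
    ring

/-- The numerator of the ratio of consecutive coefficients of the hypergeometric polynomial. -/
def hypNum (N a : ℕ) (v : ℚ) (k : ℕ) : ℚ :=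
  k * (N + 1 - k) - 2 * a * k + (N + 1) * a - a ^ 2 + v

/-- The coefficients of the hypergeometric polynomial of degree `N`. -/
noncomputable def hypCoeff (N a : ℕ) (v : ℚ) (k : ℕ) : ℚ :=
  if k ≤ N then ∏ i ∈ range k, hypNum N a v i / ((i + 1) * (N - i)) else 0

theorem hypCoeff_succ {N k : ℕ} (a : ℕ) (v : ℚ) (hk : k < N) :
    (k + 1) * (N - k) * hypCoeff N a v (k + 1) = hypNum N a v k * hypCoeff N a v k := by
  have h1 : (k : ℚ) + 1 ≠ 0 := by positivity
  have h2 : (N : ℚ) - k ≠ 0 := sub_ne_zero.2 (by exact_mod_cast hk.ne')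
  rw [hypCoeff, hypCoeff, if_pos (Nat.succ_le_of_lt hk), if_pos hk.le, prod_range_succ]
  field_simp

theorem factorial_sq_mul_hypCoeff (N a : ℕ) (v : ℚ) :
    (N.factorial : ℚ) ^ 2 * hypCoeff N a v N = ∏ i ∈ range N, hypNum N a v i := by
  have h1 : ∏ i ∈ range N, ((i : ℚ) + 1) = N.factorial := by
    rw [← prod_range_add_one_eq_factorial]
    push_cast
    rfl
  have h2 : ∏ i ∈ range N, ((N : ℚ) - i) = N.factorial := by
    rw [← h1, ← prod_range_reflect]
    refine prod_congr rfl fun i hi => ?_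
    have hi' : N - 1 - i + 1 + i = N := by
      have := mem_range.1 hi
      omega
    rw [← congrArg (Nat.cast : ℕ → ℚ) hi']
    push_cast
    ring
  have h3 : (N.factorial : ℚ) ≠ 0 := by exact_mod_cast N.factorial_ne_zero
  rw [hypCoeff, if_pos le_rfl, prod_div_distrib, prod_mul_distrib, h1, h2]
  field_simp

theorem hypergeometric_equation (N a : ℕ) (v : ℚ) :
    let G := PowerSeries.mk (hypCoeff N a v)
    (1 - PowerSeries.X) * (((N : PowerSeries ℚ) + 1) * eulerOp G - eulerOp (eulerOp G)) -
        PowerSeries.X * (-2 * (a : PowerSeries ℚ) * eulerOp G +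
          (((N : PowerSeries ℚ) + 1) * (a : PowerSeries ℚ) - (a : PowerSeries ℚ) ^ 2 +
            PowerSeries.C v) * G) =
      -PowerSeries.C (hypNum N a v N * hypCoeff N a v N) * PowerSeries.X ^ (N + 1) := by
  intro G
  have hG : ∀ j, PowerSeries.coeff j
      (((N : PowerSeries ℚ) + 1) * eulerOp G - eulerOp (eulerOp G)) =
        j * (N + 1 - j) * hypCoeff N a v j := by
    intro j
    have hc : ((N : PowerSeries ℚ) + 1) = PowerSeries.C ((N : ℚ) + 1) := by simp
    rw [hc, map_sub, PowerSeries.coeff_C_mul, coeff_eulerOp, coeff_eulerOp, coeff_eulerOp,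
      PowerSeries.coeff_mk]
    ring
  have hH : ∀ j, PowerSeries.coeff j (-2 * (a : PowerSeries ℚ) * eulerOp G +
      (((N : PowerSeries ℚ) + 1) * (a : PowerSeries ℚ) - (a : PowerSeries ℚ) ^ 2 +
            PowerSeries.C v) * G) =
        (-2 * a * j + ((N + 1) * a - a ^ 2 + v)) * hypCoeff N a v j := by
    intro j
    have hc : (-2 * (a : PowerSeries ℚ)) = PowerSeries.C (-2 * (a : ℚ)) := by
      rw [map_mul, map_neg, map_ofNat, map_natCast]
    have hc' : (((N : PowerSeries ℚ) + 1) * (a : PowerSeries ℚ) - (a : PowerSeries ℚ) ^ 2 +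
        PowerSeries.C v) =
        PowerSeries.C (((N : ℚ) + 1) * a - a ^ 2 + v) := by simp
    rw [hc, hc', map_add, PowerSeries.coeff_C_mul, PowerSeries.coeff_C_mul, coeff_eulerOp,
      PowerSeries.coeff_mk]
    ring
  ext j
  rw [sub_mul, one_mul, map_sub, map_sub, neg_mul (PowerSeries.C _), map_neg,
    PowerSeries.coeff_C_mul_X_pow]
  cases j with
  | zero => simp [hG]
  | succ j =>
    rw [PowerSeries.coeff_succ_X_mul, PowerSeries.coeff_succ_X_mul, hG, hG, hH]
    rcases lt_trichotomy j N with h | h | h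
    · rw [if_neg (by omega)]
      have := hypCoeff_succ a v h
      rw [hypNum] at this
      push_cast
      linear_combination this
    · subst h
      rw [if_pos rfl, hypNum]
      push_cast
      ring
    · rw [if_neg (by omega), hypCoeff, hypCoeff, if_neg (by omega), if_neg (by omega)]
      ring

/-- The power series `v X / (1 - X) + u X / (1 - X) ^ 2`. -/
noncomputable def blockSeries (u v : ℚ) : PowerSeries ℚ :=
  PowerSeries.mk fun k => if k = 0 then 0 else v + u * k

theorem one_sub_X_sq_mul_blockSeries (u v : ℚ) :
    (1 - PowerSeries.X) ^ 2 * blockSeries u v =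
      PowerSeries.C v * PowerSeries.X * (1 - PowerSeries.X) +
        PowerSeries.C u * PowerSeries.X := by
  have h1 : (1 - PowerSeries.X) * blockSeries u v =
      PowerSeries.X * (PowerSeries.C v + PowerSeries.C u * PowerSeries.mk 1) := by
    ext j
    rw [sub_mul, one_mul, map_sub]
    cases j with
    | zero => simp [blockSeries]
    | succ j =>
      rw [PowerSeries.coeff_succ_X_mul, PowerSeries.coeff_succ_X_mul, map_add,
        PowerSeries.coeff_C_mul, PowerSeries.coeff_C, blockSeries, PowerSeries.coeff_mk,
        PowerSeries.coeff_mk, PowerSeries.coeff_mk]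
      cases j with
      | zero => simp
      | succ j =>
        simp
        ring
  linear_combination (1 - PowerSeries.X) * h1 +
    PowerSeries.C u * PowerSeries.X * PowerSeries.mk_one_mul_one_sub_eq_one ℚ

theorem coeff_blockSeries_mul (u v : ℚ) (f : PowerSeries ℚ) (j : ℕ) :
    PowerSeries.coeff j (blockSeries u v * f) =
      ∑ i ∈ range j, (v + u * ((j - i : ℕ) : ℚ)) * PowerSeries.coeff i f := by
  rw [mul_comm, PowerSeries.coeff_mul, Nat.sum_antidiagonal_eq_sum_range_succ
    (fun i k => PowerSeries.coeff i f * PowerSeries.coeff k (blockSeries u v)), sum_range_succ]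
  simp only [blockSeries, PowerSeries.coeff_mk, Nat.sub_self, if_true, mul_zero, add_zero]
  refine sum_congr rfl fun i hi => ?_
  rw [if_neg (Nat.sub_pos_of_lt (mem_range.1 hi)).ne', mul_comm]

/-- The solution `(1 - X) ^ a * G` of the equation governing sums over compositions. -/
noncomputable def compSeries (N a : ℕ) (v : ℚ) : PowerSeries ℚ :=
  (1 - PowerSeries.X) ^ a * PowerSeries.mk (hypCoeff N a v)

theorem compSeries_equation (N a : ℕ) (v : ℚ) :
    ((N : PowerSeries ℚ) + 1) * eulerOp (compSeries N a v) - eulerOp (eulerOp (compSeries N a v)) -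
        blockSeries (a - a ^ 2) v * compSeries N a v =
      -PowerSeries.C (hypNum N a v N * hypCoeff N a v N) *
        (PowerSeries.mk 1 * (1 - PowerSeries.X) ^ a) * PowerSeries.X ^ (N + 1) := by
  have hB := hypergeometric_equation N a v
  have hK := one_sub_X_sq_mul_blockSeries ((a : ℚ) - a ^ 2) v
  have h1 := one_sub_X_mul_eulerOp_pow a
  have h2 := congrArg eulerOp h1
  have hI := PowerSeries.mk_one_mul_one_sub_eq_one ℚ
  have ha : eulerOp (a : PowerSeries ℚ) = 0 := eulerOp.map_natCast a
  have hu : PowerSeries.C ((a : ℚ) - a ^ 2) = (a : PowerSeries ℚ) - a ^ 2 := by simp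
  have hne : (1 - PowerSeries.X : PowerSeries ℚ) ^ 2 ≠ 0 := by
    refine pow_ne_zero 2 fun h => ?_
    rw [h, mul_zero] at hI
    exact zero_ne_one hI
  apply mul_left_cancel₀ hne
  simp only [compSeries, Derivation.leibniz, map_add, map_sub, map_neg, smul_eq_mul, eulerOp_X,
    Derivation.map_one_eq_zero, ha] at hB h2 ⊢
  rw [hu] at hK
  generalize PowerSeries.mk (hypCoeff N a v) = G at *
  generalize (1 - PowerSeries.X : PowerSeries ℚ) ^ a = A at *
  generalize eulerOp (eulerOp G) = G2 at *
  generalize eulerOp G = G1 at *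
  generalize eulerOp (eulerOp A) = A2 at *
  generalize eulerOp A = A1 at *
  generalize blockSeries ((a : ℚ) - a ^ 2) v = K at *
  generalize (PowerSeries.mk 1 : PowerSeries ℚ) = I at *
  generalize PowerSeries.C (hypNum N a v N * hypCoeff N a v N) = c at *
  generalize PowerSeries.C v = v' at *
  generalize (PowerSeries.X : PowerSeries ℚ) = x at *
  linear_combination -(1 - x) * G * h2 +
    (((N : PowerSeries ℚ) + 1) * (1 - x) * G - 2 * (1 - x) * G1 - G * (x - a * x)) * h1 +
    (1 - x) * A * hB - A * G * hK + (1 - x) * A * c * x ^ (N + 1) * hI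

theorem coeff_compSeries {N j : ℕ} (a : ℕ) (v : ℚ) (hj : j ≤ N) :
    (j : ℚ) * (N + 1 - j) * PowerSeries.coeff j (compSeries N a v) =
      ∑ i ∈ range j, (v + (a - a ^ 2) * ((j - i : ℕ) : ℚ)) *
        PowerSeries.coeff i (compSeries N a v) := by
  have h := congrArg (PowerSeries.coeff j) (compSeries_equation N a v)
  have hc : ((N : PowerSeries ℚ) + 1) = PowerSeries.C ((N : ℚ) + 1) := by simp
  rw [map_sub, map_sub, coeff_blockSeries_mul, hc, PowerSeries.coeff_C_mul, coeff_eulerOp,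
    coeff_eulerOp, coeff_eulerOp, PowerSeries.coeff_mul_X_pow', if_neg (by omega)] at h
  linear_combination h

theorem sum_coeff_compSeries (N a : ℕ) (v : ℚ) :
    ∑ i ∈ range (N + 1), (v + (a - a ^ 2) * ((N + 1 - i : ℕ) : ℚ)) *
      PowerSeries.coeff i (compSeries N a v) = hypNum N a v N * hypCoeff N a v N := by
  have h := congrArg (PowerSeries.coeff (N + 1)) (compSeries_equation N a v)
  have hc : ((N : PowerSeries ℚ) + 1) = PowerSeries.C ((N : ℚ) + 1) := by simp
  rw [map_sub, map_sub, coeff_blockSeries_mul, hc, PowerSeries.coeff_C_mul, coeff_eulerOp,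
    coeff_eulerOp, coeff_eulerOp, PowerSeries.coeff_mul_X_pow', if_pos le_rfl, Nat.sub_self,
    PowerSeries.coeff_zero_eq_constantCoeff_apply] at h
  have hA : PowerSeries.constantCoeff (-PowerSeries.C (hypNum N a v N * hypCoeff N a v N) *
      (PowerSeries.mk 1 * (1 - PowerSeries.X) ^ a)) = -(hypNum N a v N * hypCoeff N a v N) := by
    simp [← PowerSeries.coeff_zero_eq_constantCoeff_apply (PowerSeries.mk 1)]
  rw [hA] at h
  push_cast at h ⊢
  linear_combination -h

theorem sum_partialSumWeight_eq_coeff (N a : ℕ) (v : ℚ) {j : ℕ} (hj : j ≤ N) :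
    ∑ c : Composition j, partialSumWeight (fun b => v + (a - a ^ 2) * b)
      (fun s => ((s : ℚ) * (((N + 1 : ℕ) : ℚ) - s))⁻¹) c.blocks =
        PowerSeries.coeff j (compSeries N a v) := by
  induction j using Nat.strong_induction_on with
  | _ j ih =>
    cases j with
    | zero =>
      have h0 : hypCoeff N a v 0 = 1 := by simp [hypCoeff]
      have hb : ∀ c : Composition 0, c.blocks = [] := fun c =>
        List.eq_nil_of_length_eq_zero (Nat.le_zero.1 c.length_le)
      have hc : Fintype.card (Composition 0) = 1 := by simp [composition_card]
      simp [hb, partialSumWeight, hc, compSeries, h0,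
        ← PowerSeries.coeff_zero_eq_constantCoeff_apply (PowerSeries.mk _)]
    | succ j =>
      have h := coeff_compSeries a v hj
      have h1 : ((j + 1 : ℕ) : ℚ) ≠ 0 := by positivity
      have h2 : (N : ℚ) + 1 - ((j + 1 : ℕ) : ℚ) ≠ 0 := by
        refine sub_ne_zero.2 ?_
        exact_mod_cast (by omega : N + 1 ≠ j + 1)
      rw [sum_partialSumWeight_succ, sum_congr rfl fun i hi => by
        rw [ih i (mem_range.1 hi) ((mem_range.1 hi).le.trans hj)], ← h]
      push_cast at h1 h2 ⊢
      field_simp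

theorem factorial_sq_mul_eval_Pgen (N a : ℕ) (x : Fin 2 → ℚ) (hx : x 0 = a - a ^ 2) :
    ((N + 1).factorial : ℚ) ^ 2 * eval x (Pgen (N + 1)) =
      ∏ i ∈ range (N + 1), hypNum N a (x 1) i := by
  rw [eval_Pgen (Nat.succ_le_succ N.zero_le), sum_prod_div_Lval_mul_Rval, hx,
    sum_congr rfl fun i hi => by
      rw [sum_partialSumWeight_eq_coeff N a (x 1) (Nat.lt_succ_iff.1 (mem_range.1 hi))],
    sum_coeff_compSeries, prod_range_succ, ← factorial_sq_mul_hypCoeff, Nat.factorial_succ]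
  have h : ((N + 1 : ℕ) : ℚ) ≠ 0 := by positivity
  push_cast at h ⊢
  field_simp

theorem prod_range_two_mul_eq_prod_reflect {M : Type*} [CommMonoid M] (f : ℕ → M) (m : ℕ) :
    ∏ i ∈ range (2 * m), f i = ∏ i ∈ range m, f i * f (m + (m - 1 - i)) := by
  rw [two_mul, prod_range_add, prod_mul_distrib, prod_range_reflect (fun i => f (m + i))]

/-- Even case of the factorization theorem: for `n = 2m`, `m ≥ 1`,
`(n!)² ⬝ P_n(u,v) = ∏_{i=0}^{m-1} [(u+v+q_i)(u+v+q_{i+1}) + r_i u]`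
where `q_i = i(n-i)` and `r_i = (n-1-2i)²`. -/
theorem composition_sum_factorization_even (m : ℕ) (hm : 1 ≤ m) (n : ℕ) (hn : n = 2 * m)
    (q r : ℕ → MvPolynomial (Fin 2) ℚ)
    (hq : ∀ i, q i = C ((i : ℚ) * ((n : ℚ) - i)))
    (hr : ∀ i, r i = C (((n : ℚ) - 1 - 2 * i) ^ 2)) :
    (((n.factorial : ℚ) ^ 2) • Pgen n : MvPolynomial (Fin 2) ℚ) =
      ∏ i ∈ Finset.range m,
        ((X 0 + X 1 + q i) * (X 0 + X 1 + q (i + 1)) + r i * X 0) := by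
  obtain ⟨N, rfl⟩ : ∃ N, n = N + 1 := ⟨n - 1, by omega⟩
  refine funext_set
    (fun i : Fin 2 => if i = 0 then Set.range fun a : ℕ => ((a : ℚ) + 1) - (a + 1) ^ 2
      else Set.univ) (fun i => ?_) fun x hx => ?_
  · split_ifs
    · refine Set.infinite_range_of_injective fun a b hab => ?_
      have h : ((a : ℚ) - b) * (a + b + 1) = 0 := by
        linear_combination -hab
      have hpos : (a : ℚ) + b + 1 ≠ 0 := by positivity
      exact_mod_cast sub_eq_zero.1 ((mul_eq_zero.1 h).resolve_right hpos)
    · exact Set.infinite_univ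
  · obtain ⟨a, ha⟩ : ∃ a : ℕ, ((a : ℚ) + 1) - (a + 1) ^ 2 = x 0 := by
      simpa using hx 0 (Set.mem_univ _)
    have hx0 : x 0 = ((a + 1 : ℕ) : ℚ) - ((a + 1 : ℕ) : ℚ) ^ 2 := by
      rw [← ha]
      push_cast
      rfl
    rw [smul_eval, factorial_sq_mul_eval_Pgen N (a + 1) x hx0, hn,
      prod_range_two_mul_eq_prod_reflect, map_prod]
    refine prod_congr rfl fun i hi => ?_
    have hi' : m - 1 - i + i + 1 = m := by
      have := mem_range.1 hi
      omega
    have hm' : ((m - 1 - i : ℕ) : ℚ) = m - 1 - i := by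
      rw [eq_sub_iff_add_eq, eq_sub_iff_add_eq]
      exact_mod_cast hi'
    have hN : (N : ℚ) = 2 * m - 1 := by
      rw [eq_sub_iff_add_eq]
      exact_mod_cast hn
    simp only [hq, hr, map_add, map_mul, eval_X, eval_C, hypNum]
    push_cast
    rw [hm', hx0, hN]
    push_cast
    ring
end

section
/- For positive integers l ≤ n, the sum over all l-compositions p = (p_1,…,p_l) of n of (p_1 p_2 ⋯ p_l)/(L(p)·R(p)) equals (1/n) · e_{l−1}( 1/(1·2), 1/(2·3), …, 1/((n−1)·n) ), where e_{l−1} is the (l−1)-st elementary symmetric polynomial evaluated at the n−1 listed rational numbers. -/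
open Finset MvPolynomial

/-- The contribution of a list of parts, built from the right: a part `x` in front of parts
with sum `s` contributes `x / ((x + s) * (N - s))`. -/
noncomputable def chainWeight (N : ℚ) : List ℕ → ℚ
  | [] => 1
  | x :: p => (x : ℚ) / (((x + p.sum : ℕ) : ℚ) * (N - (p.sum : ℕ))) * chainWeight N p

theorem chainWeight_eq_div (N : ℚ) (p : List ℕ) :
    chainWeight N p = (p.map (fun i : ℕ => (i : ℚ))).prod /
      ((∏ j ∈ Finset.range p.length, (N - ((p.drop (j + 1)).sum : ℕ))) *
        ∏ j ∈ Finset.range p.length, (((p.drop j).sum : ℕ) : ℚ)) := by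
  induction p with
  | nil => simp [chainWeight]
  | cons x p ih =>
    rw [chainWeight, ih, div_mul_div_comm, List.length_cons, Finset.prod_range_succ',
      Finset.prod_range_succ']
    simp only [List.map_cons, List.prod_cons, List.drop_succ_cons, List.drop_zero, List.sum_cons]
    congr 1
    ring

theorem Lval_eq_prod_drop (p : List ℕ) :
    Lval p = ∏ j ∈ Finset.range p.length, ((p.sum : ℚ) - ((p.drop (j + 1)).sum : ℕ)) := by
  refine Finset.prod_congr rfl fun j _ => ?_
  rw [← List.sum_take_add_sum_drop p (j + 1)]
  push_cast
  ring

theorem Rval_eq_prod_drop (p : List ℕ) :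
    Rval p = ∏ j ∈ Finset.range p.length, (((p.drop j).sum : ℕ) : ℚ) := by
  rw [Rval, Lval, List.length_reverse, ← Finset.prod_range_reflect]
  refine Finset.prod_congr rfl fun j hj => ?_
  rw [Finset.mem_range] at hj
  rw [List.take_reverse, List.sum_reverse]
  congr 4
  omega

theorem prod_div_Lval_mul_Rval (p : List ℕ) :
    (p.map (fun i : ℕ => (i : ℚ))).prod / (Lval p * Rval p) = chainWeight p.sum p := by
  rw [chainWeight_eq_div, Lval_eq_prod_drop, Rval_eq_prod_drop]

/-- The lists of `l` positive integers with sum `b`. -/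
def compositionLists : ℕ → ℕ → Finset (List ℕ)
  | 0, b => if b = 0 then {[]} else ∅
  | l + 1, b => (Finset.range b).biUnion fun a =>
      (compositionLists l a).image (List.cons (b - a))

theorem mem_compositionLists {l b : ℕ} {p : List ℕ} :
    p ∈ compositionLists l b ↔ p.length = l ∧ p.sum = b ∧ ∀ i ∈ p, 0 < i := by
  induction l generalizing b p with
  | zero =>
    rw [compositionLists]
    split_ifs with hb
    · subst hb
      simp only [Finset.mem_singleton, List.length_eq_zero_iff]
      constructor
      · rintro rfl
        simp
      · exact fun h => h.1
    · simp only [Finset.notMem_empty, List.length_eq_zero_iff, false_iff]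
      rintro ⟨rfl, h, -⟩
      exact hb (by simpa using h.symm)
  | succ l ih =>
    simp only [compositionLists, Finset.mem_biUnion, Finset.mem_range, Finset.mem_image, ih]
    constructor
    · rintro ⟨a, hab, q, ⟨hl, hs, hp⟩, rfl⟩
      refine ⟨by simp [hl], by simp only [List.sum_cons]; omega, ?_⟩
      simp only [List.mem_cons, forall_eq_or_imp]
      exact ⟨by omega, hp⟩
    · rintro ⟨hl, hs, hp⟩
      cases p with
      | nil => simp at hl
      | cons x q =>
        simp only [List.mem_cons, forall_eq_or_imp] at hp
        simp only [List.sum_cons] at hs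
        refine ⟨q.sum, by omega, q, ⟨by simpa using hl, rfl, hp.2⟩, ?_⟩
        congr 1
        omega

theorem sum_composition_eq_sum_compositionLists (l n : ℕ) (f : List ℕ → ℚ) :
    ∑ c ∈ Finset.univ.filter (fun c : Composition n => c.length = l), f c.blocks =
      ∑ p ∈ compositionLists l n, f p := by
  refine Finset.sum_bij (fun c _ => c.blocks) ?_ ?_ ?_ ?_
  · intro c hc
    rw [mem_compositionLists]
    exact ⟨by simpa using hc, c.blocks_sum, fun i hi => c.blocks_pos hi⟩
  · intro c _ d _ h
    exact Composition.ext h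
  · intro p hp
    rw [mem_compositionLists] at hp
    exact ⟨⟨p, fun {i} hi => hp.2.2 i hi, hp.2.1⟩, by simpa [Composition.length] using hp.1, rfl⟩
  · exact fun _ _ => rfl

/-- The total weight of the lists of `l` positive integers with sum `b`. -/
noncomputable def chainSum (N : ℚ) (l b : ℕ) : ℚ :=
  ∑ p ∈ compositionLists l b, chainWeight N p

theorem chainSum_zero_left (N : ℚ) (b : ℕ) : chainSum N 0 b = if b = 0 then 1 else 0 := by
  rw [chainSum, compositionLists]
  split_ifs <;> simp [chainWeight]

theorem chainSum_succ_zero (N : ℚ) (l : ℕ) : chainSum N (l + 1) 0 = 0 := by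
  simp [chainSum, compositionLists]

theorem mul_chainSum_succ (N : ℚ) (l b : ℕ) :
    (b : ℚ) * chainSum N (l + 1) b =
      ∑ a ∈ Finset.range b, ((b : ℚ) - a) * (chainSum N l a / (N - a)) := by
  rw [chainSum, compositionLists, Finset.sum_biUnion, Finset.mul_sum]
  · refine Finset.sum_congr rfl fun a ha => ?_
    rw [Finset.mem_range] at ha
    have hb : (b : ℚ) ≠ 0 := by
      have : b ≠ 0 := by omega
      exact_mod_cast this
    rw [Finset.sum_image fun p _ q _ h => (List.cons.inj h).2, chainSum, Finset.sum_div,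
      Finset.mul_sum, Finset.mul_sum]
    refine Finset.sum_congr rfl fun p hp => ?_
    obtain ⟨-, hs, -⟩ := mem_compositionLists.1 hp
    rw [chainWeight, hs, Nat.sub_add_cancel ha.le, Nat.cast_sub ha.le, div_mul_eq_div_div]
    field_simp
  · intro a ha c hc hac
    rw [Function.onFun, Finset.disjoint_left]
    intro p hp hq
    simp only [Finset.coe_range, Set.mem_Iio] at ha hc
    obtain ⟨p, -, rfl⟩ := Finset.mem_image.1 hp
    obtain ⟨q, -, h⟩ := Finset.mem_image.1 hq
    have := (List.cons.inj h).1
    omega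

theorem sum_range_sub_mul_succ (h : ℕ → ℚ) (b : ℕ) :
    ∑ a ∈ Finset.range (b + 1), (((b + 1 : ℕ) : ℚ) - a) * h a =
      ∑ a ∈ Finset.range b, ((b : ℚ) - a) * h a + ∑ a ∈ Finset.range (b + 1), h a := by
  have hz : ∑ a ∈ Finset.range b, ((b : ℚ) - a) * h a =
      ∑ a ∈ Finset.range (b + 1), ((b : ℚ) - a) * h a := by
    simp [Finset.sum_range_succ]
  rw [hz, ← Finset.sum_add_distrib]
  refine Finset.sum_congr rfl fun a _ => ?_
  push_cast
  ring

/-- A sequence with prescribed second differences is a discrete double sum. -/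
theorem eq_sum_range_of_second_difference {n : ℕ} {f h : ℕ → ℚ} (h0 : f 0 = 0) (h1 : f 1 = h 0)
    (hf : ∀ b, b + 1 < n → f (b + 2) - 2 * f (b + 1) + f b = h (b + 1)) {b : ℕ} (hb : b ≤ n) :
    f b = ∑ a ∈ Finset.range b, ((b : ℚ) - a) * h a := by
  induction b using Nat.twoStepInduction with
  | zero => simpa using h0
  | one => simpa using h1
  | more b ih ih' =>
    have e := sum_range_sub_mul_succ h (b + 1)
    rw [sum_range_sub_mul_succ h b] at e
    have e' := ih' (by omega)
    rw [sum_range_sub_mul_succ h b, ← ih (by omega)] at e'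
    rw [e, ← ih (by omega), Finset.sum_range_succ h (b + 1)]
    linarith [hf b (by omega)]

/-- For `m ≥ 1`, the `k`-th elementary symmetric polynomial in `1 / (i * (i + 1))`, `1 ≤ i < m`;
for `m = 0` the value is `0`. -/
def esymmReciprocal : ℕ → ℕ → ℚ
  | _, 0 => 0
  | 0, _ + 1 => 1
  | k + 1, m + 1 => esymmReciprocal (k + 1) m + esymmReciprocal k m / (m * (m + 1))

theorem esymmReciprocal_zero (k : ℕ) : esymmReciprocal k 0 = 0 := by
  cases k <;> rfl

theorem esymmReciprocal_succ_sub (k m : ℕ) :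
    esymmReciprocal (k + 1) (m + 1) - esymmReciprocal (k + 1) m =
      esymmReciprocal k m / (m * (m + 1)) := by
  rw [esymmReciprocal]
  ring

theorem esymm_eq_esymmReciprocal (k m : ℕ) :
    ((Finset.Icc 1 m).val.map (fun i : ℕ => 1 / ((i : ℚ) * ((i : ℚ) + 1)))).esymm k =
      esymmReciprocal k (m + 1) := by
  induction m generalizing k with
  | zero =>
    cases k with
    | zero => simp [Multiset.esymm, esymmReciprocal]
    | succ k => simp [Multiset.esymm, esymmReciprocal, Multiset.powersetCard_zero_right]
  | succ m ih =>
    cases k with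
    | zero => simp [Multiset.esymm, esymmReciprocal]
    | succ k =>
      rw [← Finset.insert_Icc_right_eq_Icc_add_one (by omega),
        Finset.insert_val_of_notMem (by simp), Multiset.map_cons, esymmReciprocal, ← ih, ← ih,
        Multiset.esymm, Multiset.powersetCard_cons, Multiset.map_add, Multiset.sum_add,
        Multiset.map_map]
      simp only [Function.comp_def, Multiset.prod_cons, Multiset.sum_map_mul_left]
      rw [Multiset.esymm, Multiset.esymm]
      ring

theorem choose_second_difference (b m : ℕ) :
    ((b + 2).choose (m + 2) : ℚ) - 2 * (b + 1).choose (m + 2) + b.choose (m + 2) =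
      b.choose m := by
  have h1 := Nat.choose_succ_succ (b + 1) (m + 1)
  have h2 := Nat.choose_succ_succ b m
  have h3 := Nat.choose_succ_succ b (m + 1)
  simp only [Nat.succ_eq_add_one, add_assoc, Nat.reduceAdd] at h1 h2 h3
  rw [h1, h3, h2]
  push_cast
  ring

/-- The closed form of `b * chainSum n (k + 1) b`. -/
noncomputable def chainClosedForm (n k b : ℕ) : ℚ :=
  ∑ m ∈ Finset.range n, (esymmReciprocal k (m + 1) - esymmReciprocal k m) *
    ((b.choose (m + 1) : ℚ) / n.choose (m + 1))

theorem chainClosedForm_self (n k : ℕ) : chainClosedForm n k n = esymmReciprocal k n := by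
  rw [← sub_zero (esymmReciprocal k n), ← esymmReciprocal_zero k, ← Finset.sum_range_sub]
  refine Finset.sum_congr rfl fun m hm => ?_
  rw [Finset.mem_range] at hm
  have : (n.choose (m + 1) : ℚ) ≠ 0 := by exact_mod_cast (Nat.choose_pos (by omega)).ne'
  rw [div_self this, mul_one]

theorem sum_esymmReciprocal_mul_sub {n b : ℕ} (k : ℕ) (hb : b < n) :
    ∑ m ∈ Finset.range n, esymmReciprocal k m *
      ((b.choose m : ℚ) / n.choose m - (b.choose (m + 1) : ℚ) / n.choose (m + 1)) =
      chainClosedForm n k b := by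
  have h := Finset.sum_range_sub
    (fun m => esymmReciprocal k m * ((b.choose m : ℚ) / n.choose m)) n
  simp only [esymmReciprocal_zero, Nat.choose_eq_zero_of_lt hb, Nat.cast_zero, zero_div,
    mul_zero, zero_mul, sub_zero] at h
  rw [← add_zero (∑ m ∈ Finset.range n, _), ← h, ← Finset.sum_add_distrib, chainClosedForm]
  refine Finset.sum_congr rfl fun m _ => ?_
  ring

theorem choose_div_choose_sub {n b m : ℕ} (hm : m + 1 < n) :
    ((b + 1 : ℕ) : ℚ) * (n - (b + 1 : ℕ)) * (b.choose m / n.choose (m + 2)) =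
      ((m + 1 : ℕ) : ℚ) * ((m + 1 : ℕ) + 1) *
        (((b + 1).choose (m + 1) : ℚ) / n.choose (m + 1) -
          ((b + 1).choose (m + 2) : ℚ) / n.choose (m + 2)) := by
  have hc1 : (n.choose (m + 1) : ℚ) ≠ 0 := by exact_mod_cast (Nat.choose_pos (by omega)).ne'
  have hc2 : (n.choose (m + 2) : ℚ) ≠ 0 := by exact_mod_cast (Nat.choose_pos (by omega)).ne'
  have e1 : ((b : ℚ) + 1) * b.choose m = (b + 1).choose (m + 1) * (m + 1) := by
    exact_mod_cast Nat.add_one_mul_choose_eq b m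
  have key : ∀ a : ℕ, (a.choose (m + 2) : ℚ) * (m + 2) = a.choose (m + 1) * (a - (m + 1)) := by
    intro a
    rcases le_or_gt (m + 1) a with ha | ha
    · have := Nat.choose_succ_right_eq a (m + 1)
      have h : (a.choose (m + 1 + 1) : ℚ) * ((m + 1 + 1 : ℕ) : ℚ) =
          a.choose (m + 1) * ((a - (m + 1) : ℕ) : ℚ) := by exact_mod_cast this
      rw [Nat.cast_sub ha] at h
      push_cast at h
      linear_combination h
    · rw [Nat.choose_eq_zero_of_lt ha, Nat.choose_eq_zero_of_lt (by omega)]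
      simp
  have e2 := key n
  have e3 := key (b + 1)
  push_cast at e3 ⊢
  field_simp
  linear_combination (n.choose (m + 1) : ℚ) * (n - (b + 1)) * e1 -
    (m + 1) * ((b + 1).choose (m + 1) : ℚ) * e2 + (m + 1) * (n.choose (m + 1) : ℚ) * e3

theorem chainClosedForm_second_difference {n b : ℕ} (k : ℕ) (hb : b + 1 < n) :
    chainClosedForm n (k + 1) (b + 2) - 2 * chainClosedForm n (k + 1) (b + 1) +
      chainClosedForm n (k + 1) b =
      chainClosedForm n k (b + 1) / ((b + 1 : ℕ) * (n - (b + 1 : ℕ))) := by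
  have hb1 : ((b + 1 : ℕ) : ℚ) ≠ 0 := by positivity
  have hb2 : (n : ℚ) - (b + 1 : ℕ) ≠ 0 := by
    rw [sub_ne_zero]
    exact_mod_cast hb.ne'
  rw [eq_div_iff (mul_ne_zero hb1 hb2), ← sum_esymmReciprocal_mul_sub k hb]
  simp only [chainClosedForm]
  rw [Finset.mul_sum, ← Finset.sum_sub_distrib, ← Finset.sum_add_distrib, Finset.sum_mul]
  refine Finset.sum_congr rfl fun m hm => ?_
  rw [Finset.mem_range] at hm
  rw [esymmReciprocal_succ_sub]
  cases m with
  | zero => simp [esymmReciprocal_zero]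
  | succ m =>
    have hd : ((m + 1 : ℕ) : ℚ) * ((m + 1 : ℕ) + 1) ≠ 0 := by positivity
    have h := choose_div_choose_sub (b := b) hm
    rw [← choose_second_difference, mul_comm (_ * _ : ℚ) (_ - _), ← div_eq_iff hd] at h
    linear_combination esymmReciprocal k (m + 1) * h

theorem mul_chainSum_eq_chainClosedForm {n : ℕ} (hn : 0 < n) (k : ℕ) {b : ℕ} (hb : b ≤ n) :
    (b : ℚ) * chainSum n (k + 1) b = chainClosedForm n k b := by
  induction k generalizing b with
  | zero =>
    obtain ⟨n, rfl⟩ := Nat.exists_eq_add_of_lt hn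
    rw [mul_chainSum_succ, chainClosedForm, Finset.sum_range_succ']
    cases b with
    | zero => simp
    | succ b =>
      rw [Finset.sum_range_succ']
      simp [chainSum_zero_left, esymmReciprocal, div_eq_mul_inv]
  | succ k ih =>
    rw [mul_chainSum_succ]
    symm
    refine eq_sum_range_of_second_difference (n := n) ?_ ?_ ?_ hb
    · simp [chainClosedForm]
    · rw [chainSum_succ_zero, zero_div]
      refine Finset.sum_eq_zero fun m _ => ?_
      cases m with
      | zero => simp [esymmReciprocal_succ_sub]
      | succ m => simp [Nat.choose_eq_zero_of_lt]
    · intro b hb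
      have hb1 : ((b + 1 : ℕ) : ℚ) ≠ 0 := by positivity
      rw [chainClosedForm_second_difference k hb, ← ih hb.le, mul_div_mul_left _ _ hb1]

/-- Identity (1): `∑ p₁⋯p_l/(L(p)R(p)) = (1/n) · e_{l-1}(1/(1·2), 1/(2·3), …, 1/((n-1)·n))`,
the sum over all `l`-compositions of `n`. -/
theorem composition_sum_prod_parts (l n : ℕ) (hl : 1 ≤ l) (hln : l ≤ n) :
    (∑ c ∈ Finset.univ.filter (fun c : Composition n => c.length = l),
        (c.blocks.map (fun i : ℕ => (i : ℚ))).prod / (Lval c.blocks * Rval c.blocks)) =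
      (1 / (n : ℚ)) *
        ((Finset.Icc 1 (n - 1)).val.map
            (fun i : ℕ => 1 / ((i : ℚ) * ((i : ℚ) + 1)))).esymm (l - 1) := by
  have hn : 0 < n := by omega
  have hn' : (n : ℚ) ≠ 0 := by positivity
  obtain ⟨k, rfl⟩ : ∃ k, l = k + 1 := ⟨l - 1, by omega⟩
  simp only [prod_div_Lval_mul_Rval, Composition.blocks_sum]
  rw [sum_composition_eq_sum_compositionLists _ _ (chainWeight n), esymm_eq_esymmReciprocal,
    Nat.sub_add_cancel hn, Nat.add_sub_cancel, ← chainClosedForm_self,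
    ← mul_chainSum_eq_chainClosedForm hn k le_rfl, chainSum]
  field_simp
end
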